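/- Let s ≥ 0 and let T be the integral operator on L²((0,∞), dx) (complex-valued square-integrable functions) defined by (Tf)(x) = ∫₀^∞ K(x,y) f(y) dy, where K(x,y) = -(i/y)(x/y)^s for x < y and K(x,y) = (i/x)(y/x)^s for x > y. Then for all f, g ∈ L²((0,∞), dx), the double integral ∫₀^∞ ∫₀^∞ K(x,y) f(y) conj(g(x)) dy dx converges absolutely and satisfies |∫₀^∞ ∫₀^∞ K(x,y) f(y) conj(g(x)) dy dx| ≤ (s + 1/2)⁻¹ ‖f‖₂ ‖g‖₂. In particular T extends to a bounded operator on L²((0,∞), dx) with operator norm at most (s + 1/2)⁻¹. -/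

import Mathlib

open MeasureTheory Complex

noncomputable section

/-- Lebesgue measure on the half-line `(0,∞)`. -/
def halfLineMeasure : Measure ℝ := volume.restrict (Set.Ioi (0 : ℝ))

/-- The kernel `K(x,y) = -(i/y)(x/y)^s` for `x < y`, `K(x,y) = (i/x)(y/x)^s` for `x > y`. -/
def kernelK (s x y : ℝ) : ℂ :=
  if x < y then -(Complex.I / y) * (((x / y) ^ s : ℝ) : ℂ)
  else (Complex.I / x) * (((y / x) ^ s : ℝ) : ℂ)


/-- The lower triangular (Hardy type) kernel. -/
def aK (s x y : ℝ) : ℝ := if y < x then y ^ s * x ^ (-s - 1) else 0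

lemma aK_meas (s : ℝ) : Measurable (fun z : ℝ × ℝ => aK s z.1 z.2) := by
  unfold aK
  refine Measurable.ite (measurableSet_lt measurable_snd measurable_fst) ?_ measurable_const
  exact (measurable_snd.pow_const s).mul (measurable_fst.pow_const _)

lemma aK_nonneg (s : ℝ) {x y : ℝ} (hx : 0 < x) (hy : 0 < y) : 0 ≤ aK s x y := by
  unfold aK; split_ifs <;> positivity

lemma ite_int_Ioi (y : ℝ) (hy : 0 < y) (C p : ℝ) (hp : p < -1) :
    Integrable (fun x : ℝ => if y < x then C * x ^ p else 0) halfLineMeasure ∧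
    ∫ x, (if y < x then C * x ^ p else 0) ∂halfLineMeasure = C * (-y ^ (p + 1) / (p + 1)) := by
  have e : (fun x : ℝ => if y < x then C * x ^ p else 0)
      = (Set.Ioi y).indicator (fun x => C * x ^ p) := by
    ext x; simp [Set.indicator]
  have i : Set.Ioi y ∩ Set.Ioi 0 = Set.Ioi y := by
    ext x; simp; intro h; linarith
  rw [e, integrable_indicator_iff measurableSet_Ioi, integral_indicator measurableSet_Ioi]
  unfold halfLineMeasure
  rw [IntegrableOn, Measure.restrict_restrict measurableSet_Ioi, i, integral_const_mul,
    integral_Ioi_rpow_of_lt hp hy]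
  exact ⟨(integrableOn_Ioi_rpow_of_lt hp hy).const_mul C, rfl⟩

lemma ite_int_Iio (x : ℝ) (hx : 0 < x) (C p : ℝ) (hp : -1 < p) :
    Integrable (fun y : ℝ => if y < x then C * y ^ p else 0) halfLineMeasure ∧
    ∫ y, (if y < x then C * y ^ p else 0) ∂halfLineMeasure = C * (x ^ (p + 1) / (p + 1)) := by
  have e : (fun y : ℝ => if y < x then C * y ^ p else 0)
      = (Set.Iio x).indicator (fun y => C * y ^ p) := by
    ext y; simp [Set.indicator]
  have i : Set.Iio x ∩ Set.Ioi 0 = Set.Ioo 0 x := by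
    ext y; simp [and_comm]
  rw [e, integrable_indicator_iff measurableSet_Iio, integral_indicator measurableSet_Iio]
  unfold halfLineMeasure
  rw [IntegrableOn, Measure.restrict_restrict measurableSet_Iio, i, integral_const_mul,
    ← integral_Ioc_eq_integral_Ioo, ← intervalIntegral.integral_of_le hx.le,
    integral_rpow (Or.inl hp), Real.zero_rpow (by linarith), sub_zero]
  refine ⟨Integrable.const_mul ?_ C, rfl⟩
  have := (intervalIntegral.intervalIntegrable_rpow' (a := 0) (b := x) hp)
  rw [intervalIntegrable_iff_integrableOn_Ioo_of_le hx.le] at this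
  exact this

instance : SFinite halfLineMeasure := by unfold halfLineMeasure; infer_instance
instance : NullSingletonClass halfLineMeasure := by unfold halfLineMeasure; infer_instance

lemma ae_pos : ∀ᵐ x ∂halfLineMeasure, 0 < x := by
  unfold halfLineMeasure
  exact ae_restrict_mem measurableSet_Ioi

lemma ae_pos_prod : ∀ᵐ z ∂(halfLineMeasure.prod halfLineMeasure), 0 < z.1 ∧ 0 < z.2 :=
  (Measure.quasiMeasurePreserving_fst.ae ae_pos).and (Measure.quasiMeasurePreserving_snd.ae ae_pos)

lemma ae_ne_prod : ∀ᵐ z ∂(halfLineMeasure.prod halfLineMeasure), z.1 ≠ z.2 := by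
  rw [Measure.ae_prod_iff_ae_ae]
  · refine Filter.Eventually.of_forall fun x => ?_
    have := (Set.countable_singleton x).ae_notMem halfLineMeasure
    filter_upwards [this] with y hy h
    exact hy (by simp_all)
  · exact (measurableSet_eq_fun measurable_fst measurable_snd).compl

/-- Schur-type integrability, first weight. -/
lemma W_int (s : ℝ) (hs : 0 ≤ s) (g : ℝ → ℂ) (hg : MemLp g 2 halfLineMeasure) :
    Integrable (fun z : ℝ × ℝ => (if z.2 < z.1 then z.1 ^ (-s - 1/2) * z.2 ^ (s - 1/2) else 0)
      * ‖g z.1‖ ^ 2) (halfLineMeasure.prod halfLineMeasure) := by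
  rw [integrable_prod_iff]
  · constructor
    · filter_upwards [ae_pos] with x hx
      exact (ite_int_Iio x hx _ _ (by linarith)).1.mul_const _
    · have h2 : Integrable (fun x => (s + 1/2)⁻¹ * ‖g x‖ ^ 2) halfLineMeasure :=
        ((memLp_two_iff_integrable_sq_norm hg.1).1 hg).const_mul _
      refine h2.congr ?_
      filter_upwards [ae_pos] with x hx
      have h1 := (ite_int_Iio x hx (x ^ (-s - 1/2)) (s - 1/2) (by linarith)).2
      have : ∀ᵐ y ∂halfLineMeasure,
          ‖(if y < x then x ^ (-s - 1/2) * y ^ (s - 1/2) else 0) * ‖g x‖ ^ 2‖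
          = (if y < x then x ^ (-s - 1/2) * y ^ (s - 1/2) else 0) * ‖g x‖ ^ 2 := by
        filter_upwards [ae_pos] with y hy
        apply Real.norm_of_nonneg
        split_ifs <;> positivity
      rw [integral_congr_ae this, integral_mul_const, h1, ← mul_div_assoc, ← Real.rpow_add hx]
      ring_nf
      simp
  · refine AEStronglyMeasurable.mul ?_ ?_
    · refine Measurable.aestronglyMeasurable ?_
      refine Measurable.ite (measurableSet_lt measurable_snd measurable_fst) ?_ measurable_const
      exact (measurable_fst.pow_const _).mul (measurable_snd.pow_const _)
    · exact (hg.1.comp_fst.norm.pow 2)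

/-- Schur-type integrability, second weight. -/
lemma V_int (s : ℝ) (hs : 0 ≤ s) (f : ℝ → ℂ) (hf : MemLp f 2 halfLineMeasure) :
    Integrable (fun z : ℝ × ℝ => (if z.2 < z.1 then z.2 ^ (s + 1/2) * z.1 ^ (-s - 3/2) else 0)
      * ‖f z.2‖ ^ 2) (halfLineMeasure.prod halfLineMeasure) := by
  rw [integrable_prod_iff']
  · constructor
    · filter_upwards [ae_pos] with y hy
      exact (ite_int_Ioi y hy _ _ (by linarith)).1.mul_const _
    · have h2 : Integrable (fun x => (s + 1/2)⁻¹ * ‖f x‖ ^ 2) halfLineMeasure :=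
        ((memLp_two_iff_integrable_sq_norm hf.1).1 hf).const_mul _
      refine h2.congr ?_
      filter_upwards [ae_pos] with y hy
      have h1 := (ite_int_Ioi y hy (y ^ (s + 1/2)) (-s - 3/2) (by linarith)).2
      have : ∀ᵐ x ∂halfLineMeasure,
          ‖(if y < x then y ^ (s + 1/2) * x ^ (-s - 3/2) else 0) * ‖f y‖ ^ 2‖
          = (if y < x then y ^ (s + 1/2) * x ^ (-s - 3/2) else 0) * ‖f y‖ ^ 2 := by
        filter_upwards [ae_pos] with x hx
        apply Real.norm_of_nonneg
        split_ifs <;> positivity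
      rw [integral_congr_ae this, integral_mul_const, h1, neg_div, ← div_neg, ← mul_div_assoc,
        ← Real.rpow_add hy]
      ring_nf
      simp
  · refine AEStronglyMeasurable.mul ?_ ?_
    · refine Measurable.aestronglyMeasurable ?_
      refine Measurable.ite (measurableSet_lt measurable_snd measurable_fst) ?_ measurable_const
      exact (measurable_snd.pow_const _).mul (measurable_fst.pow_const _)
    · exact (hf.1.comp_snd.norm.pow 2)

/-- Absolute convergence for the triangular kernel. -/
lemma aK_int (s : ℝ) (hs : 0 ≤ s) (f g : ℝ → ℂ)
    (hf : MemLp f 2 halfLineMeasure) (hg : MemLp g 2 halfLineMeasure) :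
    Integrable (fun z : ℝ × ℝ => (aK s z.1 z.2 : ℂ) * f z.2 * (starRingEnd ℂ) (g z.1))
      (halfLineMeasure.prod halfLineMeasure) := by
  refine Integrable.mono' ((W_int s hs g hg).add (V_int s hs f hf)) ?_ ?_
  · refine AEStronglyMeasurable.mul (AEStronglyMeasurable.mul ?_ hf.1.comp_snd) ?_
    · exact (Complex.measurable_ofReal.comp (aK_meas s)).aestronglyMeasurable
    · exact Complex.continuous_conj.comp_aestronglyMeasurable hg.1.comp_fst
  · filter_upwards [ae_pos_prod] with z hz
    obtain ⟨hx, hy⟩ := hz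
    have h0 := aK_nonneg s hx hy
    simp only [norm_mul, Complex.norm_real, RCLike.norm_conj, Real.norm_of_nonneg h0, Pi.add_apply]
    unfold aK
    split_ifs with h
    · set t := z.1 ^ (1/2 : ℝ) * z.2 ^ (-(1/2) : ℝ) with ht
      have htp : 0 < t := by positivity
      have e1 : z.1 ^ (-s - 1/2) * z.2 ^ (s - 1/2) = (z.2 ^ s * z.1 ^ (-s - 1)) * t := by
        rw [ht, show -s - 1/2 = (-s-1) + 1/2 by ring, show s - 1/2 = s + (-(1/2)) by ring,
          Real.rpow_add hx, Real.rpow_add hy]; ring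
      have e2 : z.2 ^ (s + 1/2) * z.1 ^ (-s - 3/2) = (z.2 ^ s * z.1 ^ (-s - 1)) * t⁻¹ := by
        rw [ht, mul_inv, ← Real.rpow_neg hx.le, ← Real.rpow_neg hy.le, neg_neg,
          show -s - 3/2 = (-s-1) + (-(1/2)) by ring,
          Real.rpow_add hx, Real.rpow_add hy]; ring
      rw [e1, e2]
      have hA : 0 ≤ z.2 ^ s * z.1 ^ (-s - 1) := by positivity
      have key : ‖f z.2‖ * ‖g z.1‖ ≤ t * ‖g z.1‖ ^ 2 + t⁻¹ * ‖f z.2‖ ^ 2 := by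
        have h3 : 0 ≤ t⁻¹ * (t * ‖g z.1‖ - ‖f z.2‖) ^ 2 := by positivity
        have h4 : t⁻¹ * (t * ‖g z.1‖ - ‖f z.2‖) ^ 2
          = t * ‖g z.1‖ ^ 2 + t⁻¹ * ‖f z.2‖ ^ 2 - 2 * (‖f z.2‖ * ‖g z.1‖) := by
          field_simp; ring
        have : 0 ≤ ‖f z.2‖ * ‖g z.1‖ := by positivity
        linarith
      calc _ = (z.2 ^ s * z.1 ^ (-s - 1)) * (‖f z.2‖ * ‖g z.1‖) := by ring
        _ ≤ (z.2 ^ s * z.1 ^ (-s - 1)) * _ := mul_le_mul_of_nonneg_left key hA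
        _ = _ := by ring
    · simp

/-- The kernel of `A* A`. -/
lemma aK_comp (s : ℝ) (hs : 0 ≤ s) {y z : ℝ} (hy : 0 < y) (hz : 0 < z) (hne : y ≠ z) :
    Integrable (fun x => aK s x y * aK s x z) halfLineMeasure ∧
    ∫ x, aK s x y * aK s x z ∂halfLineMeasure = (2 * s + 1)⁻¹ * (aK s y z + aK s z y) := by
  have aux : ∀ y z : ℝ, 0 < y → y < z →
    Integrable (fun x => aK s x y * aK s x z) halfLineMeasure ∧
    ∫ x, aK s x y * aK s x z ∂halfLineMeasure = (2 * s + 1)⁻¹ * (aK s y z + aK s z y) := by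
    intro y z hy hyz
    have hz : 0 < z := hy.trans hyz
    have e : (fun x => if z < x then (y ^ s * z ^ s) * x ^ (-2 * s - 2) else 0)
       =ᵐ[halfLineMeasure] (fun x => aK s x y * aK s x z) := by
      filter_upwards [ae_pos] with x hx
      unfold aK
      by_cases h : z < x
      · rw [if_pos h, if_pos h, if_pos (hyz.trans h),
          show -2 * s - 2 = (-s - 1) + (-s - 1) by ring, Real.rpow_add hx]
        ring
      · simp [h]
    have h1 := ite_int_Ioi z hz (y ^ s * z ^ s) (-2 * s - 2) (by linarith)
    refine ⟨h1.1.congr e, ?_⟩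
    rw [← integral_congr_ae e, h1.2]
    unfold aK
    rw [if_neg hyz.not_gt, if_pos hyz, show -2 * s - 2 + 1 = -(2*s+1) by ring, neg_div_neg_eq,
      zero_add, show -s - 1 = s + -(2*s+1) by ring, Real.rpow_add hz]
    ring
  rcases lt_or_gt_of_ne hne with h | h
  · exact aux y z hy h
  · have := aux z y hz h
    simp only [mul_comm (aK s _ y), add_comm (aK s y z)]
    exact this

/-- The Hardy type operator `A`. -/
def opA (s : ℝ) (f : ℝ → ℂ) (x : ℝ) : ℂ := ∫ y, (aK s x y : ℂ) * f y ∂halfLineMeasure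

lemma cauchy_schwarz (u v : ℝ → ℂ) (hu : MemLp u 2 halfLineMeasure)
    (hv : MemLp v 2 halfLineMeasure) :
    ‖∫ x, u x * (starRingEnd ℂ) (v x) ∂halfLineMeasure‖ ≤
      (eLpNorm u 2 halfLineMeasure).toReal * (eLpNorm v 2 halfLineMeasure).toReal := by
  have h := norm_inner_le_norm (𝕜 := ℂ) (hv.toLp v) (hu.toLp u)
  rw [L2.inner_def, Lp.norm_toLp, Lp.norm_toLp, mul_comm] at h
  refine le_trans (le_of_eq ?_) h
  congr 1
  refine integral_congr_ae ?_
  filter_upwards [hu.coeFn_toLp, hv.coeFn_toLp] with x h1 h2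
  rw [h1, h2]
  simp

lemma mul_conj_int (u v : ℝ → ℂ) (hu : MemLp u 2 halfLineMeasure)
    (hv : MemLp v 2 halfLineMeasure) :
    Integrable (fun x => u x * (starRingEnd ℂ) (v x)) halfLineMeasure := by
  have := hu.integrable_mul hv.star
  exact this

lemma ofReal_sq_norm (z : ℂ) : ((‖z‖ ^ 2 : ℝ) : ℂ) = z * (starRingEnd ℂ) z := by
  rw [Complex.mul_conj, Complex.normSq_eq_norm_sq]

lemma triple_int (s : ℝ) (hs : 0 ≤ s) (f : ℝ → ℂ) (hf : MemLp f 2 halfLineMeasure) :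
    Integrable (fun z : (ℝ × ℝ) × ℝ => ((aK s z.2 z.1.1 : ℂ) * f z.1.1) *
      ((aK s z.2 z.1.2 : ℂ) * (starRingEnd ℂ) (f z.1.2)))
      ((halfLineMeasure.prod halfLineMeasure).prod halfLineMeasure) := by
  have hm : ∀ g : (ℝ × ℝ) × ℝ → ℝ × ℝ, Measurable g →
      AEStronglyMeasurable (fun z => (aK s (g z).1 (g z).2 : ℂ))
        ((halfLineMeasure.prod halfLineMeasure).prod halfLineMeasure) := fun g hg =>
    (Complex.measurable_ofReal.comp ((aK_meas s).comp hg)).aestronglyMeasurable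
  have h1 := aK_int s hs f f hf hf
  have h2 := h1.swap
  rw [integrable_prod_iff]
  · constructor
    · filter_upwards [ae_pos_prod, ae_ne_prod] with p hp hne
      have := (aK_comp s hs hp.1 hp.2 hne).1.ofReal (𝕜 := ℂ)
      refine (this.mul_const (f p.1 * (starRingEnd ℂ) (f p.2))).congr ?_
      refine Filter.Eventually.of_forall fun x => ?_
      simp; ring
    · refine (((h1.norm).add h2.norm).const_mul (2 * s + 1)⁻¹).congr ?_
      filter_upwards [ae_pos_prod, ae_ne_prod] with p hp hne
      have e : (fun x => ‖((aK s x p.1 : ℂ) * f p.1) * ((aK s x p.2 : ℂ) * (starRingEnd ℂ) (f p.2))‖)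
         =ᵐ[halfLineMeasure] fun x => (aK s x p.1 * aK s x p.2) * (‖f p.1‖ * ‖f p.2‖) := by
        filter_upwards [ae_pos] with x hx
        simp only [norm_mul, Complex.norm_real, RCLike.norm_conj,
          Real.norm_of_nonneg (aK_nonneg s hx hp.1), Real.norm_of_nonneg (aK_nonneg s hx hp.2)]
        ring
      rw [integral_congr_ae e, integral_mul_const, (aK_comp s hs hp.1 hp.2 hne).2]
      simp only [Pi.add_apply, Function.comp_apply, Prod.fst_swap, Prod.snd_swap,
          norm_mul, Complex.norm_real, RCLike.norm_conj,
          Real.norm_of_nonneg (aK_nonneg s hp.1 hp.2), Real.norm_of_nonneg (aK_nonneg s hp.2 hp.1)]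
      ring
  · refine AEStronglyMeasurable.mul (AEStronglyMeasurable.mul ?_ ?_)
      (AEStronglyMeasurable.mul ?_ ?_)
    · exact hm (fun z => (z.2, z.1.1)) (by fun_prop)
    · exact hf.1.comp_fst.comp_fst
    · exact hm (fun z => (z.2, z.1.2)) (by fun_prop)
    · exact Complex.continuous_conj.comp_aestronglyMeasurable hf.1.comp_snd.comp_fst

lemma conj_opA (s : ℝ) (f : ℝ → ℂ) (x : ℝ) : (starRingEnd ℂ) (opA s f x)
    = ∫ y, (aK s x y : ℂ) * (starRingEnd ℂ) (f y) ∂halfLineMeasure := by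
  unfold opA
  rw [← integral_conj]
  simp

lemma opA_meas (s : ℝ) (f : ℝ → ℂ) (hf : MemLp f 2 halfLineMeasure) :
    AEStronglyMeasurable (opA s f) halfLineMeasure := by
  unfold opA
  refine AEStronglyMeasurable.integral_prod_right'
    (f := fun z : ℝ × ℝ => (aK s z.1 z.2 : ℂ) * f z.2) ?_
  exact (Complex.measurable_ofReal.comp (aK_meas s)).aestronglyMeasurable.mul hf.1.comp_snd

lemma opA_sq (s : ℝ) (f : ℝ → ℂ) (x : ℝ) :
    ∫ p, ((aK s x p.1 : ℂ) * f p.1) * ((aK s x p.2 : ℂ) * (starRingEnd ℂ) (f p.2))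
      ∂(halfLineMeasure.prod halfLineMeasure) = ((‖opA s f x‖ ^ 2 : ℝ) : ℂ) := by
  rw [ofReal_sq_norm, conj_opA]
  exact integral_prod_mul (fun y => (aK s x y : ℂ) * f y)
    (fun y => (aK s x y : ℂ) * (starRingEnd ℂ) (f y))

lemma opA_memLp (s : ℝ) (hs : 0 ≤ s) (f : ℝ → ℂ) (hf : MemLp f 2 halfLineMeasure) :
    MemLp (opA s f) 2 halfLineMeasure := by
  rw [memLp_two_iff_integrable_sq_norm (opA_meas s f hf)]
  have h := (triple_int s hs f hf).integral_prod_right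
  simp only [opA_sq] at h
  exact h.re

/-- First Fubini form. -/
lemma fub1 (s : ℝ) (hs : 0 ≤ s) (f g : ℝ → ℂ)
    (hf : MemLp f 2 halfLineMeasure) (hg : MemLp g 2 halfLineMeasure) :
    ∫ z, (aK s z.1 z.2 : ℂ) * f z.2 * (starRingEnd ℂ) (g z.1)
      ∂(halfLineMeasure.prod halfLineMeasure)
    = ∫ x, opA s f x * (starRingEnd ℂ) (g x) ∂halfLineMeasure := by
  rw [integral_prod _ (aK_int s hs f g hf hg)]
  refine integral_congr_ae (Filter.Eventually.of_forall fun x => ?_)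
  simp only [opA]
  rw [← integral_mul_const]

lemma int2 (s : ℝ) (hs : 0 ≤ s) (f g : ℝ → ℂ)
    (hf : MemLp f 2 halfLineMeasure) (hg : MemLp g 2 halfLineMeasure) :
    Integrable (fun z : ℝ × ℝ => (aK s z.2 z.1 : ℂ) * f z.2 * (starRingEnd ℂ) (g z.1))
      (halfLineMeasure.prod halfLineMeasure) := by
  refine (Complex.conjLIE.toContinuousLinearEquiv.integrable_comp_iff.2
    (aK_int s hs g f hg hf).swap).congr ?_
  refine Filter.Eventually.of_forall fun z => ?_
  simp; ring

/-- Second Fubini form. -/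
lemma fub2 (s : ℝ) (hs : 0 ≤ s) (f g : ℝ → ℂ)
    (hf : MemLp f 2 halfLineMeasure) (hg : MemLp g 2 halfLineMeasure) :
    ∫ z, (aK s z.2 z.1 : ℂ) * f z.2 * (starRingEnd ℂ) (g z.1)
      ∂(halfLineMeasure.prod halfLineMeasure)
    = ∫ x, f x * (starRingEnd ℂ) (opA s g x) ∂halfLineMeasure := by
  rw [integral_prod_symm _ (int2 s hs f g hf hg)]
  refine integral_congr_ae (Filter.Eventually.of_forall fun y => ?_)
  simp only [conj_opA]
  rw [← integral_const_mul]
  refine integral_congr_ae (Filter.Eventually.of_forall fun x => ?_)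
  simp only []
  ring

/-- `2c ‖A f‖² = ⟨Af,f⟩ + ⟨f,Af⟩`. -/
lemma opA_identity (s : ℝ) (hs : 0 ≤ s) (f : ℝ → ℂ) (hf : MemLp f 2 halfLineMeasure) :
    (2 * s + 1 : ℂ) * ∫ x, ((‖opA s f x‖ ^ 2 : ℝ) : ℂ) ∂halfLineMeasure
      = ∫ x, opA s f x * (starRingEnd ℂ) (f x) ∂halfLineMeasure
        + ∫ x, f x * (starRingEnd ℂ) (opA s f x) ∂halfLineMeasure := by
  have hc : (2 * s + 1 : ℂ) ≠ 0 := by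
    have : (2 * s + 1 : ℝ) ≠ 0 := by positivity
    exact_mod_cast this
  rw [← fub1 s hs f f hf hf, ← fub2 s hs f f hf hf,
    ← integral_add (aK_int s hs f f hf hf) (int2 s hs f f hf hf)]
  have h := triple_int s hs f hf
  have e := (integral_prod_symm _ h).symm.trans (integral_prod _ h)
  simp only [opA_sq] at e
  rw [e, ← integral_const_mul, ← integral_prod_swap]
  refine integral_congr_ae ?_
  filter_upwards [ae_pos_prod, ae_ne_prod] with p hp hne
  have := congrArg (Complex.ofReal) (aK_comp s hs hp.2 hp.1 hne.symm).2
  rw [← integral_complex_ofReal] at this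
  have e2 : ∀ x : ℝ, ((aK s x p.2 : ℂ) * f p.2) * ((aK s x p.1 : ℂ) * (starRingEnd ℂ) (f p.1))
    = ((aK s x p.2 * aK s x p.1 : ℝ) : ℂ) * (f p.2 * (starRingEnd ℂ) (f p.1)) := by
    intro x; push_cast; ring
  simp only [Prod.fst_swap, Prod.snd_swap, e2]
  rw [integral_mul_const, this]
  push_cast
  field_simp
  ring

/-- The (unitary) Cayley transform `U = 2cA - 1`. -/
def opU (s : ℝ) (f : ℝ → ℂ) (x : ℝ) : ℂ := (2 * s + 1 : ℂ) * opA s f x - f x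

lemma opU_memLp (s : ℝ) (hs : 0 ≤ s) (f : ℝ → ℂ) (hf : MemLp f 2 halfLineMeasure) :
    MemLp (opU s f) 2 halfLineMeasure :=
  ((opA_memLp s hs f hf).const_mul _).sub hf

lemma opU_norm (s : ℝ) (hs : 0 ≤ s) (f : ℝ → ℂ) (hf : MemLp f 2 halfLineMeasure) :
    eLpNorm (opU s f) 2 halfLineMeasure = eLpNorm f 2 halfLineMeasure := by
  have hA := opA_memLp s hs f hf
  have hU := opU_memLp s hs f hf
  have key : ∫ x, ((‖opU s f x‖ ^ 2 : ℝ) : ℂ) ∂halfLineMeasure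
      = ∫ x, ((‖f x‖ ^ 2 : ℝ) : ℂ) ∂halfLineMeasure := by
    have id := opA_identity s hs f hf
    have i1 := (mul_conj_int _ _ hA hA).const_mul ((2 * s + 1 : ℂ) ^ 2)
    have i2 := (mul_conj_int _ _ hA hf).const_mul (2 * s + 1 : ℂ)
    have i3 := (mul_conj_int _ _ hf hA).const_mul (2 * s + 1 : ℂ)
    have i4 := mul_conj_int _ _ hf hf
    have e : ∀ x, ((‖opU s f x‖ ^ 2 : ℝ) : ℂ) =
      (2 * s + 1 : ℂ) ^ 2 * (opA s f x * (starRingEnd ℂ) (opA s f x))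
      - (2 * s + 1 : ℂ) * (opA s f x * (starRingEnd ℂ) (f x))
      - (2 * s + 1 : ℂ) * (f x * (starRingEnd ℂ) (opA s f x))
      + f x * (starRingEnd ℂ) (f x) := by
      intro x
      rw [ofReal_sq_norm]
      simp only [opU, map_sub, map_mul, map_add, map_one, Complex.conj_ofReal, Complex.conj_ofNat]
      ring
    simp only [e]
    have i12 : Integrable (fun x => (2 * s + 1 : ℂ) ^ 2 * (opA s f x * (starRingEnd ℂ) (opA s f x))
      - (2 * s + 1 : ℂ) * (opA s f x * (starRingEnd ℂ) (f x))) halfLineMeasure := i1.sub i2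
    have i123 : Integrable (fun x => (2 * s + 1 : ℂ) ^ 2 * (opA s f x * (starRingEnd ℂ) (opA s f x))
      - (2 * s + 1 : ℂ) * (opA s f x * (starRingEnd ℂ) (f x))
      - (2 * s + 1 : ℂ) * (f x * (starRingEnd ℂ) (opA s f x))) halfLineMeasure := i12.sub i3
    rw [integral_add i123 i4, integral_sub i12 i3, integral_sub i1 i2]
    simp only [integral_const_mul]
    simp only [ofReal_sq_norm] at id ⊢
    linear_combination (2 * s + 1 : ℂ) * id
  rw [integral_complex_ofReal, integral_complex_ofReal, Complex.ofReal_inj] at key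
  rw [hU.eLpNorm_eq_integral_rpow_norm (by norm_num) (by norm_num),
    hf.eLpNorm_eq_integral_rpow_norm (by norm_num) (by norm_num)]
  simp [key]

lemma kernelK_eq (s : ℝ) {x y : ℝ} (hx : 0 < x) (hy : 0 < y) (hne : x ≠ y) :
    kernelK s x y = Complex.I * aK s x y - Complex.I * aK s y x := by
  have aux : ∀ x y : ℝ, 0 < x → 0 < y → ((x / y) ^ s : ℝ) / y = x ^ s * y ^ (-s - 1) := by
    intro x y hx hy
    rw [Real.div_rpow hx.le hy.le, Real.rpow_sub hy, Real.rpow_neg hy.le, Real.rpow_one]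
    field_simp
  unfold kernelK aK
  rcases lt_or_gt_of_ne hne with h | h
  · rw [if_pos h, if_neg h.not_gt, if_pos h, ← aux x y hx hy]
    push_cast; ring
  · rw [if_neg h.not_gt, if_pos h, if_neg h.not_gt, ← aux y x hy hx]
    push_cast; ring

/-- For `s ≥ 0` and `f, g ∈ L²((0,∞), dx)`, the double integral
`∫∫ K(x,y) f(y) conj(g(x)) dy dx` converges absolutely and is bounded by
`(s + 1/2)⁻¹ ‖f‖₂ ‖g‖₂`; hence the integral operator with kernel `K` is bounded on
`L²((0,∞))` with norm at most `(s + 1/2)⁻¹`. -/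
theorem kernel_operator_bound (s : ℝ) (hs : 0 ≤ s) (f g : ℝ → ℂ)
    (hf : MemLp f 2 halfLineMeasure) (hg : MemLp g 2 halfLineMeasure) :
    Integrable (fun z : ℝ × ℝ => kernelK s z.1 z.2 * f z.2 * (starRingEnd ℂ) (g z.1))
      (halfLineMeasure.prod halfLineMeasure) ∧
    ‖∫ x in Set.Ioi (0:ℝ), ∫ y in Set.Ioi (0:ℝ),
        kernelK s x y * f y * (starRingEnd ℂ) (g x)‖ ≤
      (s + 1/2)⁻¹ * (eLpNorm f 2 halfLineMeasure).toReal *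
        (eLpNorm g 2 halfLineMeasure).toReal := by
  have h1 := aK_int s hs f g hf hg
  have h2 := int2 s hs f g hf hg
  have e : (fun z : ℝ × ℝ => Complex.I * ((aK s z.1 z.2 : ℂ) * f z.2 * (starRingEnd ℂ) (g z.1))
      - Complex.I * ((aK s z.2 z.1 : ℂ) * f z.2 * (starRingEnd ℂ) (g z.1)))
      =ᵐ[halfLineMeasure.prod halfLineMeasure]
      (fun z : ℝ × ℝ => kernelK s z.1 z.2 * f z.2 * (starRingEnd ℂ) (g z.1)) := by
    filter_upwards [ae_pos_prod, ae_ne_prod] with z hz hne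
    rw [kernelK_eq s hz.1 hz.2 hne]
    ring
  have hI := ((h1.const_mul Complex.I).sub (h2.const_mul Complex.I)).congr e
  refine ⟨hI, ?_⟩
  have hA := opA_memLp s hs f hf
  have hB := opA_memLp s hs g hg
  have hU := opU_memLp s hs f hf
  have hV := opU_memLp s hs g hg
  have hc : (2 * s + 1 : ℂ) ≠ 0 := by
    have : (2 * s + 1 : ℝ) ≠ 0 := by positivity
    exact_mod_cast this
  have eq1 : ∫ x in Set.Ioi (0:ℝ), ∫ y in Set.Ioi (0:ℝ),
      kernelK s x y * f y * (starRingEnd ℂ) (g x)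
      = Complex.I * (2 * s + 1 : ℂ)⁻¹ *
        (∫ x, opU s f x * (starRingEnd ℂ) (g x) ∂halfLineMeasure
          - ∫ x, f x * (starRingEnd ℂ) (opU s g x) ∂halfLineMeasure) := by
    have := integral_prod _ hI
    refine Eq.trans this.symm ?_
    rw [← integral_congr_ae e, integral_sub (h1.const_mul _) (h2.const_mul _),
      integral_const_mul, integral_const_mul, fub1 s hs f g hf hg, fub2 s hs f g hf hg]
    have j1 : ∫ x, opU s f x * (starRingEnd ℂ) (g x) ∂halfLineMeasure
        = (2 * s + 1 : ℂ) * ∫ x, opA s f x * (starRingEnd ℂ) (g x) ∂halfLineMeasure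
          - ∫ x, f x * (starRingEnd ℂ) (g x) ∂halfLineMeasure := by
      rw [← integral_const_mul, ← integral_sub ((mul_conj_int _ _ hA hg).const_mul _)
        (mul_conj_int _ _ hf hg)]
      refine integral_congr_ae (Filter.Eventually.of_forall fun x => ?_)
      simp only [opU]
      ring
    have j2 : ∫ x, f x * (starRingEnd ℂ) (opU s g x) ∂halfLineMeasure
        = (2 * s + 1 : ℂ) * ∫ x, f x * (starRingEnd ℂ) (opA s g x) ∂halfLineMeasure
          - ∫ x, f x * (starRingEnd ℂ) (g x) ∂halfLineMeasure := by
      rw [← integral_const_mul, ← integral_sub ((mul_conj_int _ _ hf hB).const_mul _)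
        (mul_conj_int _ _ hf hg)]
      refine integral_congr_ae (Filter.Eventually.of_forall fun x => ?_)
      simp only [opU, map_sub, map_mul, map_add, map_one, Complex.conj_ofReal, Complex.conj_ofNat]
      ring
    rw [j1, j2]
    field_simp
    ring
  rw [eq1]
  have c1 := cauchy_schwarz _ _ hU hg
  have c2 := cauchy_schwarz _ _ hf hV
  rw [opU_norm s hs f hf] at c1
  rw [opU_norm s hs g hg] at c2
  have hn : ‖Complex.I * (2 * s + 1 : ℂ)⁻¹‖ = (2 * s + 1)⁻¹ := by
    rw [norm_mul, Complex.norm_I, one_mul, norm_inv]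
    have : (2 * s + 1 : ℂ) = ((2 * s + 1 : ℝ) : ℂ) := by push_cast; rfl
    rw [this, Complex.norm_real, Real.norm_of_nonneg (by positivity)]
  rw [norm_mul, hn]
  have hsub := (norm_sub_le _ _).trans (add_le_add c1 c2)
  refine (mul_le_mul_of_nonneg_left hsub (by positivity)).trans (le_of_eq ?_)
  have : (s + 1/2)⁻¹ = 2 * (2 * s + 1)⁻¹ := by
    rw [show 2 * s + 1 = 2 * (s + 1/2) by ring, mul_inv]; ring
  rw [this]
  ring
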